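/- Let k be a field, let X be a proper scheme of finite type over k, and let L be a field extension of k. Let x₀, x₁ : Spec L → X be L-points of X and let π : Spec L(t) → Spec L be induced by the inclusion L ⊆ L(t). If the L(t)-points x₀ ∘ π and x₁ ∘ π of X are A¹-equivalent, then x₀ and x₁ are A¹-equivalent L-points of X. (Hence the natural map X(L)/∼ → X(L(t))/∼ on A¹-equivalence classes is injective, and in fact bijective.) -/

import Mathlib

open AlgebraicGeometry CategoryTheory CategoryTheory.Limits

noncomputable section

/-- The morphism `Spec S ⟶ Spec R` induced by a ring homomorphism `R →+* S`. -/
def specMapOf {R S : Type} [CommRing R] [CommRing S] (f : R →+* S) :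
    Spec (CommRingCat.of S) ⟶ Spec (CommRingCat.of R) :=
  Spec.map (CommRingCat.ofHom f)

/-- Two `M`-points `x₀, x₁` of a `k`-scheme `(X, sX)` (where the `k`-algebra structure of `M`
is recorded by the ring homomorphism `φ : k →+* M`) are *elementarily `𝔸¹`-equivalent* if there
is a `k`-morphism `f : 𝔸¹_M = Spec M[T] ⟶ X` with `f ∘ i₀ = x₀` and `f ∘ i₁ = x₁`, where
`i₀, i₁ : Spec M ⟶ 𝔸¹_M` are the sections induced by evaluation of polynomials at `0` resp. `1`. -/
def ElemA1Equiv (k : Type) [Field k] (M : Type) [Field M] (φ : k →+* M)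
    (X : Scheme) (sX : X ⟶ Spec (CommRingCat.of k))
    (x₀ x₁ : Spec (CommRingCat.of M) ⟶ X) : Prop :=
  ∃ f : Spec (CommRingCat.of (Polynomial M)) ⟶ X,
    f ≫ sX = specMapOf ((Polynomial.C : M →+* Polynomial M).comp φ) ∧
    specMapOf (Polynomial.evalRingHom (0 : M)) ≫ f = x₀ ∧
    specMapOf (Polynomial.evalRingHom (1 : M)) ≫ f = x₁

/-- `𝔸¹`-equivalence of `M`-points: the equivalence relation generated by elementary
`𝔸¹`-equivalence. -/
def A1Equiv (k : Type) [Field k] (M : Type) [Field M] (φ : k →+* M)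
    (X : Scheme) (sX : X ⟶ Spec (CommRingCat.of k))
    (x₀ x₁ : Spec (CommRingCat.of M) ⟶ X) : Prop :=
  Relation.EqvGen (ElemA1Equiv k M φ X sX) x₀ x₁

theorem exists_lift_of_isProper {X S : Scheme.{0}} (sX : X ⟶ S) [IsProper sX]
    (R K : CommRingCat.{0}) [IsDomain R] [ValuationRing R] (hK : IsField K) (i : R ⟶ K)
    (hi : let := i.hom.toAlgebra; IsFractionRing R K) (y : Spec K ⟶ X) (z : Spec R ⟶ S)
    (h : y ≫ sX = Spec.map i ≫ z) :
    ∃ l : Spec R ⟶ X, Spec.map i ≫ l = y ∧ l ≫ sX = z := by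
  have hval := (IsProper.eq_valuativeCriterion ▸ (inferInstance : IsProper sX)).1.1.1
  let := hK.toField
  let : Algebra R K := i.hom.toAlgebra
  have : IsFractionRing R K := hi
  obtain ⟨⟨l⟩⟩ := hval.existence ⟨R, K, y, z, ⟨h⟩⟩
  exact ⟨l.l, l.fac_left, l.fac_right⟩

theorem isSeparated_of_isSeparated_hom {X S : Scheme.{0}} [S.IsSeparated] (sX : X ⟶ S)
    [IsSeparated sX] : X.IsSeparated := by
  rw [Scheme.isSeparated_iff, ← terminal.comp_from sX]
  infer_instance

theorem fromFunctionField_eq_fromSpecStalkOfMem {C X : Scheme.{0}} [IrreducibleSpace C]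
    (g : C.PartialMap X) {x : C} (hx : x ∈ g.domain) :
    g.fromFunctionField =
      Spec.map (C.presheaf.stalkSpecializes ((genericPoint_spec C).specializes (Set.mem_univ x))) ≫
        g.fromSpecStalkOfMem hx := by
  unfold Scheme.PartialMap.fromFunctionField Scheme.PartialMap.fromSpecStalkOfMem
  rw [← Category.assoc]
  refine congrArg (· ≫ g.hom) ?_
  rw [← cancel_mono g.domain.ι, Category.assoc, Scheme.Opens.fromSpecStalkOfMem_ι]
  rw [Scheme.Opens.fromSpecStalkOfMem_ι]
  exact (C.SpecMap_stalkSpecializes_fromSpecStalk _).symm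

theorem domain_ofFunctionField_eq_top {S C X : Scheme.{0}} [IsIntegral C]
    (hC : ∀ x, ValuationRing (C.presheaf.stalk x)) (sC : C ⟶ S) (sX : X ⟶ S) [IsProper sX]
    (y : Spec C.functionField ⟶ X) (h : y ≫ sX = C.fromSpecStalk _ ≫ sC) :
    (Scheme.RationalMap.ofFunctionField sC sX y h).domain = ⊤ := by
  rw [eq_top_iff]
  intro x _
  have := hC x
  let i := C.presheaf.stalkSpecializes ((genericPoint_spec C).specializes (Set.mem_univ x))
  obtain ⟨l, hl, hl'⟩ := exists_lift_of_isProper sX (C.presheaf.stalk x) C.functionField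
    (Field.toIsField C.functionField) i
    (inferInstanceAs (IsFractionRing (C.presheaf.stalk x) C.functionField)) y
    (C.fromSpecStalk x ≫ sC) (by
      rw [h]
      exact (C.SpecMap_stalkSpecializes_fromSpecStalk_assoc _ _).symm)
  refine Scheme.RationalMap.mem_domain.mpr ⟨Scheme.PartialMap.ofFromSpecStalk sC sX l hl',
    Scheme.PartialMap.mem_domain_ofFromSpecStalk _ _ _ _, ?_⟩
  apply Scheme.RationalMap.eq_of_fromFunctionField_eq
  rw [Scheme.RationalMap.fromFunctionField_ofFunctionField,
    Scheme.RationalMap.fromFunctionField_toRationalMap, ← hl,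
    fromFunctionField_eq_fromSpecStalkOfMem _
      (Scheme.PartialMap.mem_domain_ofFromSpecStalk sC sX l hl'),
    Scheme.PartialMap.fromSpecStalkOfMem_ofFromSpecStalk sC sX l hl']

theorem exists_hom_of_functionField_of_isProper {S C X : Scheme.{0}} [IsIntegral C] [S.IsSeparated]
    (hC : ∀ x, ValuationRing (C.presheaf.stalk x)) (sC : C ⟶ S) (sX : X ⟶ S) [IsProper sX]
    (y : Spec C.functionField ⟶ X) (h : y ≫ sX = C.fromSpecStalk _ ≫ sC) :
    ∃ f : C ⟶ X, C.fromSpecStalk (genericPoint C) ≫ f = y := by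
  have := isSeparated_of_isSeparated_hom sX
  have hdom := domain_ofFunctionField_eq_top hC sC sX y h
  have hgen := Scheme.RationalMap.fromFunctionField_ofFunctionField sC sX y h
  generalize Scheme.RationalMap.ofFunctionField sC sX y h = φ at hdom hgen
  have h1 := Scheme.RationalMap.toRationalMap_toPartialMap φ
  have h2 : φ.toPartialMap.domain = ⊤ := hdom
  generalize φ.toPartialMap = g at h1 h2
  obtain ⟨D, hD, g⟩ := g
  obtain rfl : D = ⊤ := h2
  rw [← h1, Scheme.RationalMap.fromFunctionField_toRationalMap] at hgen
  refine ⟨C.topIso.inv ≫ g, ?_⟩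
  rw [← hgen]
  unfold Scheme.PartialMap.fromFunctionField Scheme.PartialMap.fromSpecStalkOfMem
  rw [← Category.assoc]
  refine congrArg (· ≫ g) ?_
  rw [← cancel_mono (Scheme.Opens.ι ⊤), Category.assoc, Scheme.Opens.fromSpecStalkOfMem_ι]
  simp

theorem valuationRing_of_isLocalization_atPrime {R A : Type} [CommRing R] [IsDomain R]
    [IsPrincipalIdealRing R] [CommRing A] [IsDomain A] [Algebra R A] (p : Ideal R) [p.IsPrime]
    [IsLocalization.AtPrime A p] : ValuationRing A := by
  have := IsLocalization.AtPrime.isLocalRing A p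
  have : IsPrincipalIdealRing A := ⟨fun I => by
    rw [← IsLocalization.map_under p.primeCompl A I]
    obtain ⟨a, ha⟩ := IsPrincipalIdealRing.principal (I.under R)
    exact ⟨algebraMap R A a, by
      rw [ha, ← Ideal.span, Ideal.map_span, Set.image_singleton, Ideal.span]⟩⟩
  infer_instance

theorem valuationRing_stalk (R : CommRingCat.{0}) [IsDomain R] [IsPrincipalIdealRing R]
    (x : Spec R) : ValuationRing ((Spec R).presheaf.stalk x) := by
  have h := StructureSheaf.IsLocalization.to_stalk R x
  let : Algebra R ((Spec R).presheaf.stalk x) := (StructureSheaf.toStalk R x).hom.toAlgebra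
  exact @valuationRing_of_isLocalization_atPrime R _ _ _ _ _ _ _ _ x.isPrime h

theorem exists_hom_of_fractionField (R K : CommRingCat.{0}) [IsDomain R] [IsPrincipalIdealRing R]
    (i : R ⟶ K) (hi : let := i.hom.toAlgebra; IsFractionRing R K)
    {S X : Scheme.{0}} [S.IsSeparated] (sX : X ⟶ S) [IsProper sX]
    (sC : Spec R ⟶ S) (y : Spec K ⟶ X) (h : y ≫ sX = Spec.map i ≫ sC) :
    ∃ f : Spec R ⟶ X, Spec.map i ≫ f = y := by
  obtain ⟨s, hs⟩ : ∃ s : R ⟶ (Spec R).functionField,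
      s = StructureSheaf.toStalk R (genericPoint (Spec R)) := ⟨_, rfl⟩
  have h0 : (Spec R).fromSpecStalk (genericPoint (Spec R)) = Spec.map s :=
    (Spec.fromSpecStalk_eq' R _).trans (congrArg Spec.map hs.symm)
  let a1 : Algebra R K := i.hom.toAlgebra
  have : IsFractionRing R K := hi
  have : IsFractionRing R (Spec R).functionField := inferInstance
  let e : K ≃ₐ[R] (Spec R).functionField := IsLocalization.algEquiv (nonZeroDivisors R) _ _
  let j : K ⟶ (Spec R).functionField := CommRingCat.ofHom e.toAlgHom.toRingHom
  let j' : (Spec R).functionField ⟶ K := CommRingCat.ofHom e.symm.toAlgHom.toRingHom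
  have hj : i ≫ j = s := by
    rw [hs]
    ext r
    exact e.commutes r
  have hjj : j ≫ j' = 𝟙 K := by
    ext r
    exact e.symm_apply_apply r
  obtain ⟨f, hf⟩ := exists_hom_of_functionField_of_isProper (valuationRing_stalk R) sC sX
    (Spec.map j ≫ y) (by
      rw [Category.assoc, h, h0, ← hj, Spec.map_comp, Category.assoc])
  refine ⟨f, ?_⟩
  have h2 : Spec.map j' ≫ (Spec R).fromSpecStalk (genericPoint (Spec R)) ≫ f
    = Spec.map j' ≫ Spec.map j ≫ y := congrArg (Spec.map j' ≫ ·) hf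
  rw [h0, ← hj, Spec.map_comp, Category.assoc] at h2
  rw [← Category.assoc, ← Category.assoc (Spec.map j'), ← Spec.map_comp, hjj] at h2
  simpa using h2

section

open Polynomial

/-- A place of the field `K` with values in the field `N`, given by its graph. -/
structure Place (K N : Type) [Field K] [Field N] where
  /-- `rel b c` means that `b` is finite at the place, with value `c`. -/
  rel : K → N → Prop
  zero : rel 0 0
  one : rel 1 1
  neg : ∀ {b c}, rel b c → rel (-b) (-c)
  add : ∀ {b b' c c'}, rel b c → rel b' c' → rel (b + b') (c + c')
  mul : ∀ {b b' c c'}, rel b c → rel b' c' → rel (b * b') (c * c')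
  unique : ∀ {b c c'}, rel b c → rel b c' → c = c'
  total : ∀ b, (∃ c, rel b c) ∨ rel b⁻¹ 0

namespace Place

variable {K K' N N' : Type} [Field K] [Field K'] [Field N] [Field N']

theorem ne_zero (P : Place K N) {b : K} {c : N} (h : P.rel b c) (hc : c ≠ 0) : b ≠ 0 := by
  rintro rfl
  exact hc (P.unique h P.zero)

theorem inv (P : Place K N) {b : K} {c : N} (h : P.rel b c) (hc : c ≠ 0) :
    P.rel b⁻¹ c⁻¹ := by
  have hb := P.ne_zero h hc
  rcases P.total b⁻¹ with ⟨d, hd⟩ | hd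
  · have := P.unique (P.mul h hd) (by rw [mul_inv_cancel₀ hb]; exact P.one)
    rwa [inv_eq_of_mul_eq_one_right this]
  · rw [inv_inv] at hd
    exact absurd (P.unique h hd) hc

theorem sub (P : Place K N) {b b' : K} {c c' : N} (h : P.rel b c) (h' : P.rel b' c') :
    P.rel (b - b') (c - c') := by
  rw [sub_eq_add_neg, sub_eq_add_neg]
  exact P.add h (P.neg h')

theorem div (P : Place K N) {b b' : K} {c c' : N} (h : P.rel b c) (h' : P.rel b' c')
    (hc : c' ≠ 0) : P.rel (b / b') (c / c') := by
  rw [div_eq_mul_inv, div_eq_mul_inv]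
  exact P.mul h (P.inv h' hc)

/-- The valuation ring of a place. -/
def ring (P : Place K N) : ValuationSubring K where
  carrier := {b | ∃ c, P.rel b c}
  mul_mem' := fun ⟨_, h⟩ ⟨_, h'⟩ => ⟨_, P.mul h h'⟩
  one_mem' := ⟨_, P.one⟩
  add_mem' := fun ⟨_, h⟩ ⟨_, h'⟩ => ⟨_, P.add h h'⟩
  zero_mem' := ⟨_, P.zero⟩
  neg_mem' := fun ⟨_, h⟩ => ⟨_, P.neg h⟩
  mem_or_inv_mem' := fun b => (P.total b).imp id fun h => ⟨_, h⟩

/-- The residue map of a place. -/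
def map (P : Place K N) : P.ring →+* N where
  toFun b := b.2.choose
  map_one' := P.unique (Exists.choose_spec _) P.one
  map_mul' a b := P.unique (Exists.choose_spec _) (P.mul a.2.choose_spec b.2.choose_spec)
  map_zero' := P.unique (Exists.choose_spec _) P.zero
  map_add' a b := P.unique (Exists.choose_spec _) (P.add a.2.choose_spec b.2.choose_spec)

theorem rel_map (P : Place K N) (b : P.ring) : P.rel b (P.map b) := b.2.choose_spec

theorem map_eq (P : Place K N) {b : P.ring} {c : N} (h : P.rel b c) : P.map b = c :=
  P.unique (P.rel_map b) h

/-- The restriction of a place along a field homomorphism. -/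
def comap (P : Place K N) (f : K' →+* K) : Place K' N where
  rel b c := P.rel (f b) c
  zero := by rw [map_zero]; exact P.zero
  one := by rw [map_one]; exact P.one
  neg h := by rw [map_neg]; exact P.neg h
  add h h' := by rw [map_add]; exact P.add h h'
  mul h h' := by rw [map_mul]; exact P.mul h h'
  unique := P.unique
  total b := by rw [map_inv₀]; exact P.total _

/-- The composition of two places. -/
def comp (P : Place K N) (Q : Place N N') : Place K N' where
  rel b d := ∃ c, P.rel b c ∧ Q.rel c d
  zero := ⟨0, P.zero, Q.zero⟩
  one := ⟨1, P.one, Q.one⟩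
  neg := fun ⟨_, h, h'⟩ => ⟨_, P.neg h, Q.neg h'⟩
  add := fun ⟨_, h, h'⟩ ⟨_, i, i'⟩ => ⟨_, P.add h i, Q.add h' i'⟩
  mul := fun ⟨_, h, h'⟩ ⟨_, i, i'⟩ => ⟨_, P.mul h i, Q.mul h' i'⟩
  unique := fun ⟨_, h, h'⟩ ⟨_, i, i'⟩ => by
    obtain rfl := P.unique h i
    exact Q.unique h' i'
  total b := by
    rcases P.total b with ⟨c, hc⟩ | h
    · rcases Q.total c with ⟨d, hd⟩ | h'
      · exact .inl ⟨d, c, hc, hd⟩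
      · by_cases h0 : c = 0
        · subst h0
          exact .inl ⟨0, 0, hc, Q.zero⟩
        · exact .inr ⟨_, P.inv hc h0, h'⟩
    · exact .inr ⟨_, h, Q.zero⟩

/-- The place of `L(t)` centered at the rational point `a` of the affine line. -/
def ratFunc {L : Type} [Field L] (a : L) : Place (RatFunc L) L where
  rel b c := ∃ p q : L[X], q.eval a ≠ 0 ∧ b * algebraMap _ _ q = algebraMap _ _ p ∧
    c * q.eval a = p.eval a
  zero := ⟨0, 1, by simp⟩
  one := ⟨1, 1, by simp⟩
  neg := fun ⟨p, q, h, h1, h2⟩ => ⟨-p, q, h, by simp [← h1], by simp [← h2]⟩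
  add := fun ⟨p, q, h, h1, h2⟩ ⟨p', q', h', h1', h2'⟩ =>
    ⟨p * q' + p' * q, q * q', by simp [h, h'], by
      simp only [map_mul, map_add, ← h1, ← h1']; ring, by
      simp only [eval_mul, eval_add, ← h2, ← h2']; ring⟩
  mul := fun ⟨p, q, h, h1, h2⟩ ⟨p', q', h', h1', h2'⟩ =>
    ⟨p * p', q * q', by simp [h, h'], by
      simp only [map_mul, ← h1, ← h1']; ring, by
      simp only [eval_mul, ← h2, ← h2']; ring⟩
  unique := fun {b c c'} ⟨p, q, h, h1, h2⟩ ⟨p', q', h', h1', h2'⟩ => by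
    have h3 : p * q' = p' * q := by
      apply IsFractionRing.injective L[X] (RatFunc L)
      simp only [map_mul, ← h1, ← h1']; ring
    have h4 := congrArg (eval a) h3
    simp only [eval_mul, ← h2, ← h2'] at h4
    apply mul_right_cancel₀ (mul_ne_zero h h')
    linear_combination h4
  total b := by
    have hb := RatFunc.num_div_denom b
    have hd : algebraMap L[X] (RatFunc L) b.denom ≠ 0 := by
      simpa using RatFunc.denom_ne_zero b
    rw [div_eq_iff hd] at hb
    by_cases h : b.denom.eval a = 0
    · right
      obtain ⟨x, y, hxy⟩ := RatFunc.isCoprime_num_denom b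
      have h1 : b.num.eval a ≠ 0 := by
        intro h1
        have := congrArg (eval a) hxy
        simp [h, h1] at this
      refine ⟨b.denom, b.num, h1, ?_, by simp [h]⟩
      rw [hb, ← mul_assoc, inv_mul_cancel₀, one_mul]
      rintro rfl
      simp at h1
    · exact .inl ⟨b.num.eval a / b.denom.eval a, b.num, b.denom, h, hb.symm, by field_simp⟩

theorem ratFunc_algebraMap {L : Type} [Field L] (a : L) (p : L[X]) :
    (ratFunc a).rel (algebraMap L[X] (RatFunc L) p) (p.eval a) := ⟨p, 1, by simp⟩

end Place

end

section

open Polynomial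

/-- The set of positive elements of a total order on an abelian group. -/
structure PosCone (M : Type) [AddCommGroup M] where
  /-- The positivity predicate. -/
  pos : M → Prop
  not_pos_zero : ¬ pos 0
  add : ∀ {m n}, pos m → pos n → pos (m + n)
  total : ∀ m, m = 0 ∨ pos m ∨ pos (-m)

namespace PosCone

variable {M : Type} [AddCommGroup M] (V : PosCone M) {F : Type} [Field F]

/-- `f` is supported on positive elements. -/
def Small (f : AddMonoidAlgebra F M) : Prop := ∀ m, f.coeff m ≠ 0 → V.pos m

variable {V}

theorem Small.zero : V.Small (0 : AddMonoidAlgebra F M) := fun m h => by simp at h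

theorem Small.single {m : M} (hm : V.pos m) (r : F) : V.Small (AddMonoidAlgebra.single m r) := by
  classical
  intro n h
  rw [AddMonoidAlgebra.coeff_single, Finsupp.single_apply] at h
  split_ifs at h with h'
  · exact h' ▸ hm
  · simp at h

theorem Small.add {f g : AddMonoidAlgebra F M} (hf : V.Small f) (hg : V.Small g) :
    V.Small (f + g) := fun m h => by
  by_cases h' : f.coeff m = 0
  · exact hg m (by simpa [h'] using h)
  · exact hf m h'

theorem Small.neg {f : AddMonoidAlgebra F M} (hf : V.Small f) :
    V.Small (-f) := fun m h => hf m (by simpa using h)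

theorem Small.mul {f g : AddMonoidAlgebra F M} (hf : V.Small f) (hg : V.Small g) :
    V.Small (f * g) := fun m h => by
  classical
  have := AddMonoidAlgebra.support_coeff_mul_subset f g (Finsupp.mem_support_iff.mpr h)
  obtain ⟨a, ha, b, hb, rfl⟩ := Finset.mem_add.mp this
  exact V.add (hf a (Finsupp.mem_support_iff.mp ha)) (hg b (Finsupp.mem_support_iff.mp hb))

theorem Small.const_mul {f : AddMonoidAlgebra F M} (hf : V.Small f) (c : F) :
    V.Small (AddMonoidAlgebra.single 0 c * f) := fun m h => hf m fun h' => h (by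
  have := AddMonoidAlgebra.coeff_single_mul_apply f c 0 m
  simp_all)

theorem Small.coeff_zero {f : AddMonoidAlgebra F M} (hf : V.Small f) : f.coeff 0 = 0 := by
  by_contra h
  exact V.not_pos_zero (hf 0 h)

theorem Small.eventually {ι : Type} {l : Filter ι} {V' : ι → PosCone M}
    (H : ∀ m, V.pos m → ∀ᶠ i in l, (V' i).pos m) {f : AddMonoidAlgebra F M} (hf : V.Small f) :
    ∀ᶠ i in l, (V' i).Small f := by
  have : ∀ᶠ i in l, ∀ m ∈ f.coeff.support, (V' i).pos m :=
    (Filter.eventually_all_finset _).mpr fun m hm => H m (hf m (by simpa using hm))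
  exact this.mono fun i hi m hm => hi m (by simpa using hm)

variable (V) in
/-- `f` is the sum of the constant `c` and of an element supported on positive elements. -/
def HasValue (f : AddMonoidAlgebra F M) (c : F) : Prop :=
  ∃ x, V.Small x ∧ f = AddMonoidAlgebra.single 0 c + x

theorem HasValue.unique {f : AddMonoidAlgebra F M} {c d : F} (h : V.HasValue f c)
    (h' : V.HasValue f d) : c = d := by
  obtain ⟨x, hx, rfl⟩ := h
  obtain ⟨y, hy, e⟩ := h'
  have := congrArg (fun f => AddMonoidAlgebra.coeff f 0) e
  simpa [hx.coeff_zero, hy.coeff_zero] using this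

theorem HasValue.const (c : F) : V.HasValue (AddMonoidAlgebra.single 0 c) c :=
  ⟨0, .zero, by simp⟩

theorem HasValue.one : V.HasValue (1 : AddMonoidAlgebra F M) 1 := .const 1

theorem Small.hasValue {f : AddMonoidAlgebra F M} (hf : V.Small f) : V.HasValue f 0 :=
  ⟨f, hf, by simp⟩

theorem HasValue.neg {f : AddMonoidAlgebra F M} {c : F} (h : V.HasValue f c) :
    V.HasValue (-f) (-c) := by
  obtain ⟨x, hx, rfl⟩ := h
  exact ⟨-x, hx.neg, by rw [AddMonoidAlgebra.single_neg]; ring⟩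

theorem HasValue.add {f g : AddMonoidAlgebra F M} {c d : F} (h : V.HasValue f c)
    (h' : V.HasValue g d) : V.HasValue (f + g) (c + d) := by
  obtain ⟨x, hx, rfl⟩ := h
  obtain ⟨y, hy, rfl⟩ := h'
  exact ⟨x + y, hx.add hy, by rw [AddMonoidAlgebra.single_add]; ring⟩

theorem HasValue.mul {f g : AddMonoidAlgebra F M} {c d : F} (h : V.HasValue f c)
    (h' : V.HasValue g d) : V.HasValue (f * g) (c * d) := by
  obtain ⟨x, hx, rfl⟩ := h
  obtain ⟨y, hy, rfl⟩ := h'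
  refine ⟨_, ((hx.mul hy).add (hy.const_mul c)).add (hx.const_mul d), ?_⟩
  have : (AddMonoidAlgebra.single 0 (c * d) : AddMonoidAlgebra F M) =
      AddMonoidAlgebra.single 0 c * AddMonoidAlgebra.single 0 d := by
    simp [AddMonoidAlgebra.single_mul_single]
  rw [this]
  ring

variable (V) in
theorem exists_min (s : Finset M) (hs : s.Nonempty) :
    ∃ m ∈ s, ∀ n ∈ s, n = m ∨ V.pos (n - m) := by
  induction hs using Finset.Nonempty.cons_induction with
  | singleton a => exact ⟨a, by simp⟩
  | cons a s ha hs ih =>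
    obtain ⟨m, hm, h⟩ := ih
    rcases V.total (a - m) with h' | h' | h'
    · exact absurd (sub_eq_zero.mp h' ▸ hm) ha
    · refine ⟨m, by simp [hm], fun n hn => ?_⟩
      rcases Finset.mem_cons.mp hn with rfl | hn
      · exact .inr h'
      · exact h n hn
    · refine ⟨a, by simp, fun n hn => ?_⟩
      rcases Finset.mem_cons.mp hn with rfl | hn
      · exact .inl rfl
      · right
        rw [neg_sub] at h'
        rcases h n hn with rfl | h
        · exact h'
        · simpa using V.add h h'

variable (V) in
/-- A nonzero element is a monomial times an element of value one. -/
theorem exists_eq_single_mul (f : AddMonoidAlgebra F M) (hf : f ≠ 0) :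
    ∃ m c g, c ≠ 0 ∧ V.HasValue g 1 ∧ f = AddMonoidAlgebra.single m c * g := by
  classical
  obtain ⟨m, hm, h⟩ := V.exists_min f.coeff.support (by simpa using hf)
  have hc : f.coeff m ≠ 0 := by simpa using hm
  refine ⟨m, f.coeff m, AddMonoidAlgebra.single (-m) (f.coeff m)⁻¹ * f, hc,
    ⟨AddMonoidAlgebra.single (-m) (f.coeff m)⁻¹ * f - AddMonoidAlgebra.single 0 1, ?_, by ring⟩, ?_⟩
  · intro n hn
    have h2 := AddMonoidAlgebra.coeff_single_mul_apply f (f.coeff m)⁻¹ (-m) n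
    have h3 : n ≠ 0 := by
      rintro rfl
      simp [h2, hc] at hn
    have h4 : f.coeff (m + n) ≠ 0 := fun h4 => by
      apply hn
      simp [h2, h4, h3.symm]
    rcases h _ (Finsupp.mem_support_iff.mpr h4) with h | h
    · exact absurd (by simpa using h) h3
    · simpa using h
  · rw [← mul_assoc, AddMonoidAlgebra.single_mul_single, add_neg_cancel, mul_inv_cancel₀ hc,
      ← AddMonoidAlgebra.one_def, one_mul]

section

variable {K N : Type} [Field K] [Field N]

theorem rel_of_small (P : Place K N) (Ψ : AddMonoidAlgebra F M →+* K)
    (hC : ∀ r, ∃ c, P.rel (Ψ (AddMonoidAlgebra.single 0 r)) c)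
    (hpos : ∀ m, V.pos m → P.rel (Ψ (AddMonoidAlgebra.single m 1)) 0)
    {f : AddMonoidAlgebra F M} (hf : V.Small f) : P.rel (Ψ f) 0 := by
  rw [← AddMonoidAlgebra.sum_coeff_single f, Finsupp.sum, map_sum]
  refine Finset.sum_induction _ (fun b => P.rel b 0)
    (fun a b ha hb => by simpa using P.add ha hb) P.zero fun m hm => ?_
  obtain ⟨c, hc⟩ := hC (f.coeff m)
  have := P.mul hc (hpos m (hf m (by simpa using hm)))
  rwa [← map_mul, AddMonoidAlgebra.single_mul_single, zero_add, mul_one, mul_zero] at this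

theorem rel_of_hasValue (P : Place K F) (Ψ : AddMonoidAlgebra F M →+* K)
    (hC : ∀ r, P.rel (Ψ (AddMonoidAlgebra.single 0 r)) r)
    (hpos : ∀ m, V.pos m → P.rel (Ψ (AddMonoidAlgebra.single m 1)) 0)
    {f : AddMonoidAlgebra F M} {c : F} (hf : V.HasValue f c) : P.rel (Ψ f) c := by
  obtain ⟨x, hx, rfl⟩ := hf
  rw [map_add]
  simpa using P.add (hC c) (rel_of_small P Ψ (fun r => ⟨r, hC r⟩) hpos hx)

theorem injective_of_rel (V : PosCone M) (P : Place K F) (Ψ : AddMonoidAlgebra F M →+* K)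
    (hC : ∀ r, P.rel (Ψ (AddMonoidAlgebra.single 0 r)) r)
    (hpos : ∀ m, V.pos m → P.rel (Ψ (AddMonoidAlgebra.single m 1)) 0) :
    Function.Injective Ψ := by
  rw [injective_iff_map_eq_zero]
  intro f hf
  by_contra h0
  obtain ⟨m, c, g, hc, hg, rfl⟩ := V.exists_eq_single_mul f h0
  rw [map_mul, mul_eq_zero] at hf
  rcases hf with hf | hf
  · have : Ψ (AddMonoidAlgebra.single m c * AddMonoidAlgebra.single (-m) c⁻¹) = 1 := by
      rw [AddMonoidAlgebra.single_mul_single, add_neg_cancel, mul_inv_cancel₀ hc,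
        ← AddMonoidAlgebra.one_def, map_one]
    rw [map_mul, hf, zero_mul] at this
    exact zero_ne_one this
  · exact P.ne_zero (rel_of_hasValue P Ψ hC hpos hg) one_ne_zero hf

end

section

variable [UniqueSums M]

variable (V F) in
/-- The place of the fraction field of `F[M]` attached to a total order on `M`. -/
def place : Place (FractionRing (AddMonoidAlgebra F M)) F where
  rel b c := ∃ g h, V.HasValue g c ∧ V.HasValue h 1 ∧
    b * algebraMap (AddMonoidAlgebra F M) _ h = algebraMap _ _ g
  zero := ⟨0, 1, Small.zero.hasValue, .one, by simp⟩
  one := ⟨1, 1, .one, .one, by simp⟩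
  neg := fun ⟨g, h, hg, hh, e⟩ => ⟨-g, h, hg.neg, hh, by simp [← e]⟩
  add := fun ⟨g, h, hg, hh, e⟩ ⟨g', h', hg', hh', e'⟩ =>
    ⟨g * h' + g' * h, h * h', by simpa using (hg.mul hh').add (hg'.mul hh),
      by simpa using hh.mul hh', by simp only [map_mul, map_add, ← e, ← e']; ring⟩
  mul := fun ⟨g, h, hg, hh, e⟩ ⟨g', h', hg', hh', e'⟩ =>
    ⟨g * g', h * h', hg.mul hg', by simpa using hh.mul hh',
      by simp only [map_mul, ← e, ← e']; ring⟩
  unique := fun {b c c'} ⟨g, h, hg, hh, e⟩ ⟨g', h', hg', hh', e'⟩ => by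
    have h3 : g * h' = g' * h := by
      apply IsFractionRing.injective (AddMonoidAlgebra F M) (FractionRing (AddMonoidAlgebra F M))
      simp only [map_mul, ← e, ← e']; ring
    have h4 := (hg.mul hh').unique (h3 ▸ hg'.mul hh)
    simpa using h4
  total b := by
    obtain ⟨x, y, hy, rfl⟩ := IsFractionRing.div_surjective (A := AddMonoidAlgebra F M) b
    by_cases hx : x = 0
    · exact .inl ⟨0, 0, 1, Small.zero.hasValue, .one, by simp [hx]⟩
    obtain ⟨m, c, g, hc, hg, rfl⟩ := V.exists_eq_single_mul x hx
    obtain ⟨n, d, h, hd, hh, rfl⟩ := V.exists_eq_single_mul y (nonZeroDivisors.ne_zero hy)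
    have key : ∀ {p q : M} {r s : F} {g h : AddMonoidAlgebra F M}, s ≠ 0 →
        AddMonoidAlgebra.single q s * h ≠ 0 →
        algebraMap (AddMonoidAlgebra F M) (FractionRing (AddMonoidAlgebra F M))
          (AddMonoidAlgebra.single p r * g) /
        algebraMap (AddMonoidAlgebra F M) (FractionRing (AddMonoidAlgebra F M))
          (AddMonoidAlgebra.single q s * h) * algebraMap _ _ h =
        algebraMap _ _ (AddMonoidAlgebra.single (p - q) (r / s) * g) := by
      intro p q r s g h hs hne
      have h0 : algebraMap (AddMonoidAlgebra F M) (FractionRing (AddMonoidAlgebra F M))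
          (AddMonoidAlgebra.single q s * h) ≠ 0 := by simpa using hne
      rw [div_mul_eq_mul_div, div_eq_iff h0, ← map_mul, ← map_mul]
      congr 1
      have : (AddMonoidAlgebra.single p r : AddMonoidAlgebra F M) =
          AddMonoidAlgebra.single (p - q) (r / s) * AddMonoidAlgebra.single q s := by
        rw [AddMonoidAlgebra.single_mul_single, sub_add_cancel, div_mul_cancel₀ _ hs]
      rw [this]
      ring
    rcases V.total (m - n) with h' | h' | h'
    · refine .inl ⟨c / d, _, h, ?_, hh, key hd (nonZeroDivisors.ne_zero hy)⟩
      rw [h']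
      simpa using (HasValue.const (V := V) (c / d)).mul hg
    · refine .inl ⟨0, _, h, ?_, hh, key hd (nonZeroDivisors.ne_zero hy)⟩
      simpa using (Small.single h' (c / d)).hasValue.mul hg
    · rw [neg_sub] at h'
      refine .inr ⟨_, g, ?_, hg, by rw [inv_div]; exact key hc hx⟩
      simpa using (Small.single h' (d / c)).hasValue.mul hh

theorem place_rel_algebraMap {f : AddMonoidAlgebra F M} {c : F} (hf : V.HasValue f c) :
    (V.place F).rel (algebraMap _ _ f) c := ⟨f, 1, hf, .one, by simp⟩

theorem rel_of_place_rel (P : Place (FractionRing (AddMonoidAlgebra F M)) F)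
    (hC : ∀ r, P.rel (algebraMap (AddMonoidAlgebra F M) _ (AddMonoidAlgebra.single 0 r)) r)
    (hpos : ∀ m, V.pos m → P.rel (algebraMap (AddMonoidAlgebra F M) _ (.single m 1)) 0)
    {b : FractionRing (AddMonoidAlgebra F M)} {c : F} (h : (V.place F).rel b c) : P.rel b c := by
  obtain ⟨g, h, hg, hh, e⟩ := h
  have h1 := rel_of_hasValue P (algebraMap _ _) hC hpos hg
  have h2 := rel_of_hasValue P (algebraMap _ _) hC hpos hh
  rw [← eq_div_iff (P.ne_zero h2 one_ne_zero)] at e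
  rw [e]
  simpa using P.div h1 h2 one_ne_zero

theorem place_rel_eventually {ι : Type} {l : Filter ι} {V' : ι → PosCone M}
    (H : ∀ m, V.pos m → ∀ᶠ i in l, (V' i).pos m) {b : FractionRing (AddMonoidAlgebra F M)} {c : F}
    (h : (V.place F).rel b c) : ∀ᶠ i in l, ((V' i).place F).rel b c := by
  obtain ⟨g, h, ⟨x, hx, hg⟩, ⟨y, hy, hh⟩, e⟩ := h
  filter_upwards [hx.eventually H, hy.eventually H] with i hi hi'
  exact ⟨g, h, ⟨x, hi, hg⟩, ⟨y, hi', hh⟩, e⟩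

end

end PosCone

end

section

open Polynomial

/-- The usual order on `ℤ`. -/
def intPosCone : PosCone ℤ where
  pos n := 0 < n
  not_pos_zero := lt_irrefl 0
  add := add_pos
  total m := by lia

namespace PosCone

variable {F κ M : Type} [Field F] [Field κ] [AddCommGroup M] [UniqueSums M]

theorem exists_place_of_hom [Algebra F κ] (V : PosCone M) (i j : M →+ ℤ) {u : κ} (hu : u ≠ 0)
    (O : Place κ F) (hO : ∀ r, O.rel (algebraMap F κ r) r)
    (hV : ∀ m, V.pos m → 0 < i m ∨ i m = 0 ∧ O.rel (u ^ j m) 0) :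
    ∃ W : Place (FractionRing (AddMonoidAlgebra F M)) κ,
      (∀ m r, i m = 0 → W.rel (algebraMap (AddMonoidAlgebra F M) _ (.single m r))
        (algebraMap F κ r * u ^ j m)) ∧
      ∀ m, 0 < i m → W.rel (algebraMap (AddMonoidAlgebra F M) _ (.single m 1)) 0 := by
  let g : Multiplicative M →* AddMonoidAlgebra κ ℤ :=
    { toFun := fun m => .single (i m.toAdd) (u ^ j m.toAdd)
      map_one' := by rw [toAdd_one, map_zero, map_zero, zpow_zero, AddMonoidAlgebra.one_def]
      map_mul' := fun a b => by
        rw [toAdd_mul, map_add, map_add, zpow_add₀ hu, AddMonoidAlgebra.single_mul_single] }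
  let ψ : AddMonoidAlgebra F M →+* AddMonoidAlgebra κ ℤ :=
    AddMonoidAlgebra.liftNCRingHom
      (AddMonoidAlgebra.singleZeroRingHom.comp (algebraMap F κ)) g fun _ _ => Commute.all _ _
  have hψ : ∀ m r, ψ (.single m r) = .single (i m) (algebraMap F κ r * u ^ j m) := by
    intro m r
    refine (AddMonoidAlgebra.liftNCRingHom_single _ _ _ _ _).trans ?_
    refine (AddMonoidAlgebra.single_mul_single _ _ _ _).trans ?_
    rw [zero_add]
    rfl
  let K' := FractionRing (AddMonoidAlgebra κ ℤ)
  let Ψ : AddMonoidAlgebra F M →+* K' := (algebraMap _ _).comp ψ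
  let P := intPosCone.place κ
  have h0 : ∀ m r, i m = 0 → P.rel (Ψ (.single m r)) (algebraMap F κ r * u ^ j m) := by
    intro m r hm
    simp only [Ψ, RingHom.comp_apply, hψ, hm]
    exact place_rel_algebraMap (.const _)
  have h1 : ∀ m, 0 < i m → P.rel (Ψ (.single m 1)) 0 := by
    intro m hm
    simp only [Ψ, RingHom.comp_apply, hψ]
    exact place_rel_algebraMap (Small.single (V := intPosCone) hm _).hasValue
  have hinj : Function.Injective Ψ := by
    refine injective_of_rel V (P.comp O) Ψ (fun r => ⟨_, h0 0 r (map_zero i), by simpa using hO r⟩)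
      fun m hm => ?_
    rcases hV m hm with h | ⟨h, h'⟩
    · exact ⟨0, h1 m h, O.zero⟩
    · exact ⟨_, h0 m 1 h, by simpa using h'⟩
  refine ⟨P.comap (IsFractionRing.lift hinj), fun m r hm => ?_, fun m hm => ?_⟩
  · simpa [Place.comap] using h0 m r hm
  · simpa [Place.comap] using h1 m hm

theorem comp_rel_of_place_rel [Algebra F κ] {V : PosCone M} {i j : M →+ ℤ} {u : κ}
    {O : Place κ F} (hO : ∀ r, O.rel (algebraMap F κ r) r)
    (hV : ∀ m, V.pos m → 0 < i m ∨ i m = 0 ∧ O.rel (u ^ j m) 0)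
    {W : Place (FractionRing (AddMonoidAlgebra F M)) κ}
    (hW : ∀ m r, i m = 0 → W.rel (algebraMap (AddMonoidAlgebra F M) _ (.single m r))
        (algebraMap F κ r * u ^ j m))
    (hW' : ∀ m, 0 < i m → W.rel (algebraMap (AddMonoidAlgebra F M) _ (.single m 1)) 0)
    {b : FractionRing (AddMonoidAlgebra F M)} {c : F} (h : (V.place F).rel b c) :
    (W.comp O).rel b c := by
  refine rel_of_place_rel (W.comp O) (fun r => ⟨_, hW 0 r (map_zero i), by simpa using hO r⟩)
    (fun m hm => ?_) h
  rcases hV m hm with h | ⟨h, h'⟩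
  · exact ⟨0, hW' m h, O.zero⟩
  · exact ⟨_, hW m 1 h, by simpa using h'⟩

end PosCone

end

theorem specMapOf_comp {R S T : Type} [CommRing R] [CommRing S] [CommRing T]
    (f : R →+* S) (g : S →+* T) : specMapOf (g.comp f) = specMapOf g ≫ specMapOf f :=
  Spec.map_comp (CommRingCat.ofHom f) (CommRingCat.ofHom g)

theorem specMapOf_injective {R S : Type} [CommRing R] [CommRing S] :
    Function.Injective (specMapOf : (R →+* S) → _) := fun _ _ h =>
  congrArg CommRingCat.Hom.hom (Spec.map_injective h)

theorem exists_eq_specMapOf {R S : Type} [CommRing R] [CommRing S]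
    (f : Spec (CommRingCat.of S) ⟶ Spec (CommRingCat.of R)) : ∃ g, f = specMapOf g :=
  ⟨(Spec.preimage f).hom, (Spec.map_preimage f).symm⟩

theorem hom_ext_of_injective {A K : Type} [CommRing A] [IsDomain A] [CommRing K] {i : A →+* K}
    (hi : Function.Injective i) {X : Scheme.{0}} [X.IsSeparated]
    {f g : Spec (CommRingCat.of A) ⟶ X} (h : specMapOf i ≫ f = specMapOf i ≫ g) : f = g := by
  have : IsDominant (specMapOf i) := by
    constructor
    exact (PrimeSpectrum.denseRange_comap_iff_ker_le_nilRadical _).mpr (by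
      exact ((RingHom.injective_iff_ker_eq_bot i).mp hi).le.trans bot_le)
  exact ext_of_isDominant (specMapOf i) h

/-- A point of `X` over a local ring factors through an affine chart of finite type. -/
theorem exists_chart {k A : Type} [CommRing k] [CommRing A] [IsLocalRing A] {X : Scheme.{0}}
    (sX : X ⟶ Spec (CommRingCat.of k)) [LocallyOfFiniteType sX]
    (H : Spec (CommRingCat.of A) ⟶ X) :
    ∃ (B : Type) (_ : CommRing B) (ι : Spec (CommRingCat.of B) ⟶ X) (β : B →+* A) (c : k →+* B),
      H = specMapOf β ≫ ι ∧ ι ≫ sX = specMapOf c ∧ c.FiniteType := by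
  obtain ⟨U, hU, hmem, -⟩ := exists_isAffineOpen_mem_and_subset
    (TopologicalSpace.Opens.mem_top (H (IsLocalRing.closedPoint A)))
  have htop := Scheme.preimage_eq_top_of_closedPoint_mem (R := CommRingCat.of A) H hmem
  have hr : Set.range H ⊆ Set.range hU.fromSpec := by
    rw [hU.range_fromSpec]
    rintro _ ⟨x, rfl⟩
    have : x ∈ H ⁻¹ᵁ U := by rw [htop]; trivial
    exact this
  obtain ⟨β, hβ⟩ := exists_eq_specMapOf (R := Γ(X, U)) (IsOpenImmersion.lift hU.fromSpec H hr)
  obtain ⟨c, hc⟩ := exists_eq_specMapOf (S := Γ(X, U)) (hU.fromSpec ≫ sX)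
  refine ⟨Γ(X, U), inferInstance, hU.fromSpec, β, c, ?_, hc, ?_⟩
  · rw [← hβ]
    exact (IsOpenImmersion.lift_fac _ _ _).symm
  · have : LocallyOfFiniteType (hU.fromSpec ≫ sX) := inferInstance
    rw [hc] at this
    exact (HasRingHomProperty.Spec_iff (P := @LocallyOfFiniteType)).mp this

namespace Place

variable {K N N' : Type} [Field K] [Field N] [Field N'] {X : Scheme.{0}}

/-- The `K`-point `G` extends to the valuation ring of the place `P`, and specializes to `p`. -/
def Sends (P : Place K N) (G : Spec (CommRingCat.of K) ⟶ X) (p : Spec (CommRingCat.of N) ⟶ X) :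
    Prop :=
  ∃ H : Spec (CommRingCat.of P.ring) ⟶ X,
    specMapOf P.ring.subtype ≫ H = G ∧ specMapOf P.map ≫ H = p

theorem Sends.unique [X.IsSeparated] {P : Place K N} {G : Spec (CommRingCat.of K) ⟶ X}
    {p q : Spec (CommRingCat.of N) ⟶ X} (hp : P.Sends G p) (hq : P.Sends G q) : p = q := by
  obtain ⟨H, h1, rfl⟩ := hp
  obtain ⟨H', h1', rfl⟩ := hq
  rw [hom_ext_of_injective (i := P.ring.subtype) Subtype.val_injective (h1.trans h1'.symm)]

theorem sends_of_hom (P : Place K N) {A : Type} [CommRing A] (g : A →+* K) (v : A →+* N)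
    (h : ∀ a, P.rel (g a) (v a)) (F : Spec (CommRingCat.of A) ⟶ X) :
    P.Sends (specMapOf g ≫ F) (specMapOf v ≫ F) := by
  let g' : A →+* P.ring := g.codRestrict P.ring fun a => ⟨_, h a⟩
  refine ⟨specMapOf g' ≫ F, ?_, ?_⟩
  · rw [← Category.assoc, ← specMapOf_comp]
    rfl
  · rw [← Category.assoc, ← specMapOf_comp]
    congr 2
    ext a
    exact P.map_eq (h a)

theorem exists_sends {k : Type} [Field k] (sX : X ⟶ Spec (CommRingCat.of k)) [IsProper sX]
    (P : Place K N) {φ : k →+* K} {ψ : k →+* N} (h : ∀ r, P.rel (φ r) (ψ r))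
    {G : Spec (CommRingCat.of K) ⟶ X} (hG : G ≫ sX = specMapOf φ) :
    ∃ p, P.Sends G p ∧ p ≫ sX = specMapOf ψ := by
  let φ' : k →+* P.ring := φ.codRestrict P.ring fun a => ⟨_, h a⟩
  have e : P.map.comp φ' = ψ := RingHom.ext fun a => P.map_eq (h a)
  obtain ⟨l, hl, hl'⟩ := exists_lift_of_isProper sX (CommRingCat.of P.ring) (CommRingCat.of K)
    (Field.toIsField K) (CommRingCat.ofHom P.ring.subtype)
    (inferInstanceAs (IsFractionRing P.ring K)) G (specMapOf φ') (by
      rw [hG]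
      exact specMapOf_comp φ' P.ring.subtype)
  refine ⟨_, ⟨l, hl, rfl⟩, ?_⟩
  rw [Category.assoc, hl', ← specMapOf_comp, e]

theorem Sends.exists_finset {k : Type} [Field k] (sX : X ⟶ Spec (CommRingCat.of k))
    [LocallyOfFiniteType sX] {P : Place K N} {φ : k →+* K}
    {G : Spec (CommRingCat.of K) ⟶ X} (hG : G ≫ sX = specMapOf φ)
    {p : Spec (CommRingCat.of N) ⟶ X} (h : P.Sends G p) :
    ∃ s : Finset K, (∀ b ∈ s, ∃ c, P.rel b c) ∧ ∀ P' : Place K N,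
      (∀ r c, P.rel (φ r) c → P'.rel (φ r) c) → (∀ b ∈ s, ∀ c, P.rel b c → P'.rel b c) →
      P'.Sends G p := by
  classical
  obtain ⟨H, rfl, rfl⟩ := h
  obtain ⟨B, _, ι, β, c, rfl, hc, hfin⟩ := exists_chart sX H
  let g : B →+* K := P.ring.subtype.comp β
  have hg : ∀ r, g (c r) = φ r := by
    rw [Category.assoc, Category.assoc, hc, ← specMapOf_comp, ← specMapOf_comp] at hG
    exact fun r => congrArg (fun f : k →+* K => f r) (specMapOf_injective hG)
  let := c.toAlgebra
  obtain ⟨s, hs⟩ := hfin.out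
  refine ⟨s.image g, fun b hb => ?_, fun P' h1 h2 => ?_⟩
  · obtain ⟨a, -, rfl⟩ := Finset.mem_image.mp hb
    exact (β a).2
  have key : ∀ b : B, P'.rel (g b) (P.map (β b)) := by
    intro b
    have hb : b ∈ Algebra.adjoin k (s : Set B) := hs ▸ Algebra.mem_top
    induction hb using Algebra.adjoin_induction with
    | mem x hx => exact h2 _ (Finset.mem_image_of_mem g hx) _ (P.rel_map (β x))
    | algebraMap r =>
      have := P.rel_map (β (c r))
      rw [show ((β (c r) : P.ring) : K) = φ r from hg r] at this
      rw [show g (algebraMap k B r) = φ r from hg r]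
      exact h1 r _ this
    | add x y _ _ hx hy => simpa only [map_add] using P'.add hx hy
    | mul x y _ _ hx hy => simpa only [map_mul] using P'.mul hx hy
  have := P'.sends_of_hom g (P.map.comp β) key ι
  rwa [specMapOf_comp, specMapOf_comp, Category.assoc, Category.assoc] at this

theorem Sends.of_comp [X.IsSeparated] {V : Place K N'} {W : Place K N} {O : Place N N'}
    (hV : ∀ b d, V.rel b d → (W.comp O).rel b d) {G : Spec (CommRingCat.of K) ⟶ X}
    {y : Spec (CommRingCat.of N) ⟶ X} {p : Spec (CommRingCat.of N') ⟶ X}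
    (hW : W.Sends G y) (hp : V.Sends G p) : O.Sends y p := by
  obtain ⟨H, rfl, rfl⟩ := hp
  obtain ⟨H', h1, rfl⟩ := hW
  let i : V.ring →+* W.ring := V.ring.subtype.codRestrict W.ring fun a => by
    obtain ⟨d, hd⟩ := a.2
    obtain ⟨c, hc, -⟩ := hV _ _ hd
    exact ⟨c, hc⟩
  have hi : specMapOf i ≫ H = H' := by
    apply hom_ext_of_injective (i := W.ring.subtype) Subtype.val_injective
    rw [h1, ← Category.assoc, ← specMapOf_comp]
    rfl
  rw [← hi, ← Category.assoc, ← specMapOf_comp]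
  refine O.sends_of_hom _ _ (fun a => ?_) H
  obtain ⟨c, hc, hc'⟩ := hV _ _ (V.rel_map a)
  rwa [RingHom.comp_apply, W.map_eq (b := i a) hc]

end Place

section

open Polynomial Filter Topology

/-- The order on `ℤ × ℤ` given by a linear form of slope `α`, refined by the sign `s`. -/
def slopeCone (α : ℝ) (s : ℤˣ) : PosCone (ℤ × ℤ) where
  pos m := 0 < m.1 + α * m.2 ∨ m.1 + α * m.2 = 0 ∧ 0 < s * m.2
  not_pos_zero := by simp
  add := by
    rintro ⟨a, b⟩ ⟨a', b'⟩ h h'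
    simp only [Prod.fst_add, Prod.snd_add, Int.cast_add, mul_add] at *
    rcases h with h | ⟨h, h1⟩ <;> rcases h' with h' | ⟨h', h1'⟩
    · left; linarith
    · left; linarith
    · left; linarith
    · exact .inr ⟨by linarith, by linarith⟩
  total := by
    rintro ⟨a, b⟩
    simp only [Prod.fst_neg, Prod.snd_neg, Int.cast_neg, Prod.mk_eq_zero]
    rcases lt_trichotomy (a + α * b) 0 with h | h | h
    · right; right; left; linarith
    · rcases lt_trichotomy (s * b : ℤ) 0 with h' | h' | h'
      · exact .inr (.inr (.inr ⟨by linarith, by linarith⟩))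
      · have hb : b = 0 := by simpa using h'
        subst hb
        left
        simpa using h
      · exact .inr (.inl (.inr ⟨h, h'⟩))
    · exact .inr (.inl (.inl h))

/-- The order on `ℤ × ℤ` of infinite slope, with sign `s`. -/
def endCone (s : ℤˣ) : PosCone (ℤ × ℤ) where
  pos m := 0 < s * m.2 ∨ m.2 = 0 ∧ 0 < m.1
  not_pos_zero := by simp
  add := by
    rintro ⟨a, b⟩ ⟨a', b'⟩ h h'
    simp only [Prod.fst_add, Prod.snd_add, mul_add] at *
    rcases h with h | ⟨rfl, h1⟩ <;> rcases h' with h' | ⟨rfl, h1'⟩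
    · left; linarith
    · left; linarith
    · left; linarith
    · exact .inr ⟨rfl, by linarith⟩
  total := by
    rintro ⟨a, b⟩
    simp only [Prod.fst_neg, Prod.snd_neg, Prod.mk_eq_zero]
    rcases lt_trichotomy (s * b : ℤ) 0 with h | h | h
    · right; right; left; linarith
    · have hb : b = 0 := by simpa using h
      subst hb
      rcases lt_trichotomy a 0 with h' | h' | h'
      · exact .inr (.inr (.inr ⟨rfl, by linarith⟩))
      · exact .inl ⟨h', rfl⟩
      · exact .inr (.inl (.inr ⟨rfl, h'⟩))
    · exact .inr (.inl (.inl h))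

theorem slopeCone_pos_eventually_nhds {α : ℝ} {m : ℤ × ℤ} (h : 0 < m.1 + α * m.2) :
    ∀ᶠ β in 𝓝 α, ∀ s, (slopeCone β s).pos m := by
  have : ContinuousAt (fun β : ℝ => m.1 + β * m.2) α := by fun_prop
  exact (this.eventually (lt_mem_nhds h)).mono fun β hβ s => .inl hβ

theorem slopeCone_pos_eventually_nhdsGT {α : ℝ} {m : ℤ × ℤ} (h : (slopeCone α 1).pos m) :
    ∀ᶠ β in 𝓝[>] α, ∀ s, (slopeCone β s).pos m := by
  rcases h with h | ⟨h, h'⟩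
  · exact (slopeCone_pos_eventually_nhds h).filter_mono nhdsWithin_le_nhds
  · filter_upwards [self_mem_nhdsWithin] with β hβ s
    left
    have h2 : (0 : ℝ) < m.2 := by simpa using h'
    nlinarith [mul_pos (sub_pos.mpr (Set.mem_Ioi.mp hβ)) h2]

theorem slopeCone_pos_eventually_nhdsLT {α : ℝ} {m : ℤ × ℤ} (h : (slopeCone α (-1)).pos m) :
    ∀ᶠ β in 𝓝[<] α, ∀ s, (slopeCone β s).pos m := by
  rcases h with h | ⟨h, h'⟩
  · exact (slopeCone_pos_eventually_nhds h).filter_mono nhdsWithin_le_nhds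
  · filter_upwards [self_mem_nhdsWithin] with β hβ s
    left
    have h2 : (m.2 : ℝ) < 0 := by simpa using h'
    nlinarith [mul_pos_of_neg_of_neg (sub_neg.mpr (Set.mem_Iio.mp hβ)) h2]

theorem slopeCone_pos_eventually_atTop {m : ℤ × ℤ} (h : (endCone 1).pos m) :
    ∀ᶠ β in atTop, ∀ s, (slopeCone β s).pos m := by
  rcases h with h | ⟨h, h'⟩
  · have h2 : (0 : ℝ) < m.2 := by simpa using h
    have : Tendsto (fun β : ℝ => m.1 + β * m.2) atTop atTop :=
      tendsto_atTop_add_const_left _ _ (tendsto_id.atTop_mul_const h2)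
    exact (this.eventually_gt_atTop 0).mono fun β hβ s => .inl hβ
  · exact .of_forall fun β s => .inl (by simpa [h] using h')

theorem slopeCone_pos_eventually_atBot {m : ℤ × ℤ} (h : (endCone (-1)).pos m) :
    ∀ᶠ β in atBot, ∀ s, (slopeCone β s).pos m := by
  rcases h with h | ⟨h, h'⟩
  · have h2 : (m.2 : ℝ) < 0 := by simpa using h
    have : Tendsto (fun β : ℝ => m.1 + β * m.2) atBot atTop :=
      tendsto_atTop_add_const_left _ _ (tendsto_id.atBot_mul_const_of_neg h2)
    exact (this.eventually_gt_atTop 0).mono fun β hβ s => .inl hβ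
  · exact .of_forall fun β s => .inl (by simpa [h] using h')

theorem slopeCone_pos_of_irrational {α : ℝ} (hα : Irrational α) (s s' : ℤˣ) {m : ℤ × ℤ}
    (h : (slopeCone α s).pos m) : (slopeCone α s').pos m := by
  rcases h with h | ⟨h, h'⟩
  · exact .inl h
  · have h2 : m.2 ≠ 0 := fun h2 => by simp [h2] at h'
    have := (hα.mul_intCast h2).intCast_add m.1
    rw [h] at this
    exact absurd this not_irrational_zero

theorem Place.rel_zpow {K N : Type} [Field K] [Field N] (P : Place K N) {u : K}
    (h : P.rel u 0) {n : ℤ} (hn : 0 < n) : P.rel (u ^ n) 0 := by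
  obtain ⟨k, rfl⟩ : ∃ k : ℕ, n = k + 1 := ⟨(n - 1).toNat, by lia⟩
  norm_cast
  induction k with
  | zero => simpa using h
  | succ k ih =>
    rw [pow_succ]
    simpa using P.mul (ih (by lia)) h

theorem Place.ratFunc_const {L : Type} [Field L] (a r : L) :
    (Place.ratFunc a).rel (algebraMap L (RatFunc L) r) r := by
  have := Place.ratFunc_algebraMap a (C r)
  rwa [eval_C] at this

theorem Place.ratFunc_X {L : Type} [Field L] (a : L) :
    (Place.ratFunc a).rel RatFunc.X a := by
  have := Place.ratFunc_algebraMap a (X : L[X])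
  rwa [eval_X, RatFunc.algebraMap_X] at this

section

variable {k : Type} [Field k] {X : Scheme.{0}} {sX : X ⟶ Spec (CommRingCat.of k)}
  {L : Type} [Field L] {φ : k →+* L}

theorem exists_eq_specMapOf_comp_of_fractionField {R K : Type} [CommRing R] [IsDomain R]
    [IsPrincipalIdealRing R] [Field K] [inst : Algebra R K] [IsFractionRing R K] [IsProper sX]
    {c : k →+* R} {y : Spec (CommRingCat.of K) ⟶ X}
    (h : y ≫ sX = specMapOf ((algebraMap R K).comp c)) :
    ∃ f, specMapOf (algebraMap R K) ≫ f = y := by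
  refine exists_hom_of_fractionField (CommRingCat.of R) (CommRingCat.of K)
    (CommRingCat.ofHom (algebraMap R K)) ?_ sX (specMapOf c) y (h.trans (specMapOf_comp _ _))
  have e : (algebraMap R K).toAlgebra = inst := Algebra.algebra_ext _ _ fun _ => rfl
  change @IsFractionRing R _ K _ (algebraMap R K).toAlgebra
  rw [e]
  infer_instance

theorem elemA1Equiv_of_rel {K : Type} [Field K] [Algebra L[X] K]
    [IsFractionRing L[X] K] [IsProper sX] [X.IsSeparated] {y : Spec (CommRingCat.of K) ⟶ X}
    (hy : y ≫ sX = specMapOf ((algebraMap L[X] K).comp (C.comp φ))) (P Q : Place K L)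
    (hP : ∀ f : L[X], P.rel (algebraMap L[X] K f) (f.eval 0))
    (hQ : ∀ f : L[X], Q.rel (algebraMap L[X] K f) (f.eval 1))
    {p q : Spec (CommRingCat.of L) ⟶ X} (hp : P.Sends y p) (hq : Q.Sends y q) :
    ElemA1Equiv k L φ X sX p q := by
  obtain ⟨f, rfl⟩ := exists_eq_specMapOf_comp_of_fractionField hy
  refine ⟨f, ?_, ?_, ?_⟩
  · obtain ⟨c, hc⟩ := exists_eq_specMapOf (f ≫ sX)
    rw [Category.assoc, hc, ← specMapOf_comp] at hy
    rw [hc]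
    have := specMapOf_injective hy
    refine congrArg specMapOf (RingHom.ext fun r => ?_)
    exact IsFractionRing.injective L[X] K (congrArg (fun g : k →+* K => g r) this)
  · exact (P.sends_of_hom _ (evalRingHom 0) hP f).unique hp
  · exact (Q.sends_of_hom _ (evalRingHom 1) hQ f).unique hq

theorem elemA1Equiv_of_sends [IsProper sX] [X.IsSeparated]
    {y : Spec (CommRingCat.of (RatFunc L)) ⟶ X}
    (hy : y ≫ sX = specMapOf ((algebraMap L (RatFunc L)).comp φ))
    {p q : Spec (CommRingCat.of L) ⟶ X}
    (hp : (Place.ratFunc 0).Sends y p) (hq : (Place.ratFunc 1).Sends y q) :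
    ElemA1Equiv k L φ X sX p q := by
  have e : (algebraMap L (RatFunc L)).comp φ =
      (algebraMap L[X] (RatFunc L)).comp (C.comp φ) :=
    RingHom.ext fun r => IsScalarTower.algebraMap_apply L L[X] (RatFunc L) (φ r)
  rw [e] at hy
  exact elemA1Equiv_of_rel hy _ _ (Place.ratFunc_algebraMap 0) (Place.ratFunc_algebraMap 1) hp hq

/-- The inclusion of the constants in the field of rational functions on a torus. -/
abbrev torusConst (L : Type) [Field L] :
    L →+* FractionRing (AddMonoidAlgebra L (ℤ × ℤ)) :=
  (algebraMap (AddMonoidAlgebra L (ℤ × ℤ)) (FractionRing (AddMonoidAlgebra L (ℤ × ℤ)))).comp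
    AddMonoidAlgebra.singleZeroRingHom

theorem PosCone.place_rel_torusConst (V : PosCone (ℤ × ℤ)) (r : L) :
    (V.place L).rel (torusConst L r) r := PosCone.place_rel_algebraMap (.const r)

variable {G : Spec (CommRingCat.of (FractionRing (AddMonoidAlgebra L (ℤ × ℤ)))) ⟶ X}

theorem sends_eventually [IsProper sX] (hG : G ≫ sX = specMapOf ((torusConst L).comp φ))
    {V : PosCone (ℤ × ℤ)} {l : Filter ℝ} {V' : ℝ → PosCone (ℤ × ℤ)}
    (H : ∀ m, V.pos m → ∀ᶠ i in l, (V' i).pos m) {p : Spec (CommRingCat.of L) ⟶ X}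
    (h : (V.place L).Sends G p) : ∀ᶠ i in l, ((V' i).place L).Sends G p := by
  obtain ⟨s, hs, hs'⟩ := h.exists_finset sX hG
  have : ∀ᶠ i in l, ∀ b ∈ s, ∀ c, (V.place L).rel b c → ((V' i).place L).rel b c := by
    refine (Filter.eventually_all_finset _).mpr fun b hb => ?_
    obtain ⟨c, hc⟩ := hs b hb
    filter_upwards [PosCone.place_rel_eventually H hc] with i hi c' hc'
    rwa [(V.place L).unique hc' hc]
  refine this.mono fun i hi => hs' _ (fun r c hc => ?_) hi
  rw [(V.place L).unique hc (V.place_rel_torusConst (φ r))]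
  exact (V' i).place_rel_torusConst (φ r)

theorem a1Equiv_of_slopeCone [IsProper sX] [X.IsSeparated]
    (hG : G ≫ sX = specMapOf ((torusConst L).comp φ)) (α : ℝ) {p q : Spec (CommRingCat.of L) ⟶ X}
    (hp : ((slopeCone α 1).place L).Sends G p) (hq : ((slopeCone α (-1)).place L).Sends G q) :
    A1Equiv k L φ X sX p q := by
  by_cases hα : Irrational α
  · have h := sends_eventually (V' := fun β => slopeCone β (-1)) (l := pure α) hG
      (fun m hm => eventually_pure.mpr (slopeCone_pos_of_irrational hα _ _ hm)) hp
    rw [eventually_pure] at h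
    rw [h.unique hq]
    exact .refl _
  obtain ⟨r, rfl⟩ : ∃ r : ℚ, (r : ℝ) = α := by simpa [Irrational] using hα
  obtain ⟨x, y, hxy⟩ : IsCoprime (r.den : ℤ) r.num :=
    r.isCoprime_num_den.symm
  let i : ℤ × ℤ →+ ℤ := (AddMonoidHom.mulLeft (r.den : ℤ)).comp (AddMonoidHom.fst ℤ ℤ) +
    (AddMonoidHom.mulLeft r.num).comp (AddMonoidHom.snd ℤ ℤ)
  let j : ℤ × ℤ →+ ℤ := (AddMonoidHom.mulLeft x).comp (AddMonoidHom.snd ℤ ℤ) -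
    (AddMonoidHom.mulLeft y).comp (AddMonoidHom.fst ℤ ℤ)
  have hi : ∀ m, i m = r.den * m.1 + r.num * m.2 := fun m => rfl
  have hj : ∀ m, j m = x * m.2 - y * m.1 := fun m => rfl
  have hd : (0 : ℝ) < r.den := by exact_mod_cast r.pos
  have hr : ∀ m : ℤ × ℤ, (i m : ℝ) = r.den * (m.1 + r * m.2) := fun m => by
    rw [hi, mul_add, ← mul_assoc]
    have : (r.den : ℝ) * r = r.num := by exact_mod_cast Rat.den_mul_eq_num r
    rw [this]
    push_cast
    rfl
  have hij : ∀ m, i m = 0 → r.den * j m = m.2 := fun m hm => by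
    rw [hi] at hm
    rw [hj]
    linear_combination m.2 * hxy - y * hm
  have hpos : ∀ s m, (slopeCone r s).pos m → 0 < i m ∨ i m = 0 ∧ 0 < s * j m := by
    rintro s m (h | ⟨h, h'⟩)
    · left
      have := mul_pos hd h
      rw [← hr] at this
      exact_mod_cast this
    · right
      have h0 : i m = 0 := by
        have := hr m
        rw [h, mul_zero] at this
        exact_mod_cast this
      refine ⟨h0, ?_⟩
      rw [← hij m h0, mul_left_comm] at h'
      exact pos_of_mul_pos_right h' (by positivity)
  let u : RatFunc L := RatFunc.X / (RatFunc.X - 1)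
  have hu0 : (Place.ratFunc (0 : L)).rel u 0 := by
    have := (Place.ratFunc (0 : L)).div (Place.ratFunc_X 0)
      ((Place.ratFunc (0 : L)).sub (Place.ratFunc_X 0) (Place.ratFunc 0).one) (by simp)
    simpa using this
  have hu1 : (Place.ratFunc (1 : L)).rel u⁻¹ 0 := by
    have := (Place.ratFunc (1 : L)).div
      ((Place.ratFunc (1 : L)).sub (Place.ratFunc_X 1) (Place.ratFunc 1).one)
      (Place.ratFunc_X 1) (by simp)
    simpa [u] using this
  have hu : u ≠ 0 := by
    have h1 : (RatFunc.X - 1 : RatFunc L) ≠ 0 :=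
      (Place.ratFunc 0).ne_zero ((Place.ratFunc (0 : L)).sub (Place.ratFunc_X 0)
        (Place.ratFunc 0).one) (by simp)
    exact div_ne_zero RatFunc.X_ne_zero h1
  have hV0 : ∀ m, (slopeCone r 1).pos m → 0 < i m ∨
      i m = 0 ∧ (Place.ratFunc (0 : L)).rel (u ^ j m) 0 := fun m hm =>
    (hpos 1 m hm).imp id fun h => ⟨h.1, Place.rel_zpow _ hu0 (by simpa using h.2)⟩
  have hV1 : ∀ m, (slopeCone r (-1)).pos m → 0 < i m ∨
      i m = 0 ∧ (Place.ratFunc (1 : L)).rel (u ^ j m) 0 := fun m hm =>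
    (hpos (-1) m hm).imp id fun h => ⟨h.1, by
      rw [show u ^ j m = u⁻¹ ^ (-j m) by rw [inv_zpow, zpow_neg, inv_inv]]
      exact Place.rel_zpow _ hu1 (by simpa using h.2)⟩
  obtain ⟨W, hW, hW'⟩ := PosCone.exists_place_of_hom _ i j hu _ (Place.ratFunc_const 0) hV0
  obtain ⟨y, hy, hy'⟩ := W.exists_sends sX (ψ := (algebraMap L (RatFunc L)).comp φ)
    (fun r => by
      have := hW 0 (φ r) (map_zero i)
      rw [map_zero j, zpow_zero, mul_one] at this
      exact this) hG
  refine .rel _ _ (elemA1Equiv_of_sends hy' ?_ ?_)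
  · exact hy.of_comp (fun _ _ => PosCone.comp_rel_of_place_rel (Place.ratFunc_const 0) hV0 hW hW') hp
  · exact hy.of_comp (fun _ _ => PosCone.comp_rel_of_place_rel (Place.ratFunc_const 1) hV1 hW hW') hq

theorem a1Equiv_of_endCone [IsProper sX] [X.IsSeparated]
    (hG : G ≫ sX = specMapOf ((torusConst L).comp φ)) {p q : Spec (CommRingCat.of L) ⟶ X}
    (hp : ((endCone 1).place L).Sends G p) (hq : ((endCone (-1)).place L).Sends G q) :
    A1Equiv k L φ X sX p q := by
  have hex : ∀ α s, ∃ p, ((slopeCone α s).place L).Sends G p := fun α s => by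
    obtain ⟨p, hp, -⟩ := ((slopeCone α s).place L).exists_sends sX (ψ := φ)
      (fun r => (slopeCone α s).place_rel_torusConst (φ r)) hG
    exact ⟨p, hp⟩
  choose P hP using hex
  let S := Relation.EqvGen.setoid (ElemA1Equiv k L φ X sX)
  let f : ℝ → Quotient S := fun α => Quotient.mk S (P α 1)
  have hS : ∀ α, Quotient.mk S (P α (-1)) = f α := fun α =>
    (Quotient.sound (a1Equiv_of_slopeCone hG α (hP α 1) (hP α (-1)))).symm
  have hf : IsLocallyConstant f := by
    rw [IsLocallyConstant.iff_eventually_eq]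
    intro α
    rw [← nhdsNE_sup_pure, ← nhdsLT_sup_nhdsGT, eventually_sup, eventually_sup]
    refine ⟨⟨?_, ?_⟩, eventually_pure.mpr rfl⟩
    · filter_upwards [sends_eventually (V' := fun β => slopeCone β 1) hG (fun m hm =>
        (slopeCone_pos_eventually_nhdsLT hm).mono fun β hβ => hβ 1) (hP α (-1))] with β hβ
      rw [← hS α]
      change Quotient.mk S _ = Quotient.mk S _
      rw [hβ.unique (hP β 1)]
    · filter_upwards [sends_eventually (V' := fun β => slopeCone β 1) hG (fun m hm =>
        (slopeCone_pos_eventually_nhdsGT hm).mono fun β hβ => hβ 1) (hP α 1)] with β hβ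
      change Quotient.mk S _ = Quotient.mk S _
      rw [hβ.unique (hP β 1)]
  obtain ⟨α, hα⟩ := (sends_eventually (V' := fun β => slopeCone β 1) hG (fun m hm =>
    (slopeCone_pos_eventually_atTop hm).mono fun β hβ => hβ 1) hp).exists
  obtain ⟨β, hβ⟩ := (sends_eventually (V' := fun β => slopeCone β 1) hG (fun m hm =>
    (slopeCone_pos_eventually_atBot hm).mono fun β hβ => hβ 1) hq).exists
  rw [hα.unique (hP α 1), hβ.unique (hP β 1)]
  exact Quotient.exact (s := S) (hf.apply_eq_of_preconnectedSpace α β)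

end

end

section

open Polynomial

section

variable {L : Type} [Field L]

/-- The monomials on the torus, as rational functions. -/
abbrev torusMonomial (L : Type) [Field L] (m : ℤ × ℤ) :
    FractionRing (AddMonoidAlgebra L (ℤ × ℤ)) :=
  algebraMap (AddMonoidAlgebra L (ℤ × ℤ)) _ (.single m 1)

theorem Place.rel_eval₂ {K N A : Type} [Field K] [Field N] [CommRing A] (P : Place K N)
    {f : A →+* K} {g : A →+* N} (h : ∀ a, P.rel (f a) (g a)) {b : K} {c : N} (hb : P.rel b c)
    (p : A[X]) : P.rel (p.eval₂ f b) (p.eval₂ g c) := by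
  induction p using Polynomial.induction_on' with
  | add p q hp hq => simpa only [eval₂_add] using P.add hp hq
  | monomial n a =>
    rw [eval₂_monomial, eval₂_monomial]
    refine P.mul (h a) ?_
    induction n with
    | zero => simpa using P.one
    | succ n ih => simpa only [pow_succ] using P.mul ih hb

/-- If the generators of the residue field of a place lift compatibly, so does the residue field. -/
theorem Place.exists_lift_of_rel {K N R : Type} [Field K] [Field N] [CommRing R] [IsDomain R]
    [Algebra R N] [IsFractionRing R N] (g : R →+* K) (P : Place K N)
    (hP : ∀ r, P.rel (g r) (algebraMap R N r)) :
    ∃ θ : N →+* K, (∀ r, θ (algebraMap R N r) = g r) ∧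
      ∀ Q : Place K N, (∀ r, Q.rel (g r) (algebraMap R N r)) → ∀ x, Q.rel (θ x) x := by
  have hg : Function.Injective g := by
    rw [injective_iff_map_eq_zero]
    intro r hr
    have := hP r
    rw [hr] at this
    exact IsFractionRing.injective R N (by rw [map_zero]; exact P.unique this P.zero)
  refine ⟨IsFractionRing.lift hg, IsFractionRing.lift_algebraMap hg, fun Q hQ x => ?_⟩
  obtain ⟨p, q, hq, rfl⟩ := IsFractionRing.div_surjective (A := R) x
  rw [map_div₀, IsFractionRing.lift_algebraMap, IsFractionRing.lift_algebraMap]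
  exact Q.div (hQ p) (hQ q) (IsFractionRing.to_map_ne_zero_of_mem_nonZeroDivisors hq)

theorem exists_endCone_place (s : ℤˣ) :
    ∃ W : Place (FractionRing (AddMonoidAlgebra L (ℤ × ℤ))) (RatFunc L),
      (∀ r, W.rel (torusConst L r) (algebraMap L (RatFunc L) r)) ∧
      W.rel (torusMonomial L (1, 0)) RatFunc.X ∧ W.rel (torusMonomial L (0, s)) 0 ∧
      ∀ b c, ((endCone s).place L).rel b c → (W.comp (Place.ratFunc 0)).rel b c := by
  let i : ℤ × ℤ →+ ℤ := (AddMonoidHom.mulLeft (s : ℤ)).comp (AddMonoidHom.snd ℤ ℤ)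
  let j : ℤ × ℤ →+ ℤ := AddMonoidHom.fst ℤ ℤ
  have hV : ∀ m, (endCone s).pos m → 0 < i m ∨
      i m = 0 ∧ (Place.ratFunc (0 : L)).rel (RatFunc.X ^ j m) 0 := fun m hm =>
    hm.imp id fun h => ⟨by
      change (s : ℤ) * m.2 = 0
      rw [h.1, mul_zero], Place.rel_zpow _ (Place.ratFunc_X 0) h.2⟩
  obtain ⟨W, hW, hW'⟩ := PosCone.exists_place_of_hom _ i j RatFunc.X_ne_zero _
    (Place.ratFunc_const 0) hV
  refine ⟨W, fun r => ?_, ?_, hW' _ ?_, fun _ _ h =>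
    PosCone.comp_rel_of_place_rel (Place.ratFunc_const 0) hV hW hW' h⟩
  · have := hW 0 r (map_zero i)
    rw [map_zero j, zpow_zero, mul_one] at this
    exact this
  · have := hW (1, 0) 1 (mul_zero _)
    rw [map_one, one_mul] at this
    change W.rel _ (RatFunc.X ^ (1 : ℤ)) at this
    rwa [zpow_one] at this
  · change 0 < (s : ℤ) * s
    rw [Int.units_coe_mul_self]
    exact one_pos

variable {k : Type} [Field k] {X : Scheme.{0}} {sX : X ⟶ Spec (CommRingCat.of k)}
  {φ : k →+* L}

/-- Specializing an elementary equivalence over `L(t)` at `t = 0`. -/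
theorem a1Equiv_of_elemA1Equiv_ratFunc [IsProper sX] [X.IsSeparated]
    {y₀ y₁ : Spec (CommRingCat.of (RatFunc L)) ⟶ X}
    (h : ElemA1Equiv k (RatFunc L) ((algebraMap L (RatFunc L)).comp φ) X sX y₀ y₁)
    {p q : Spec (CommRingCat.of L) ⟶ X}
    (hp : (Place.ratFunc 0).Sends y₀ p) (hq : (Place.ratFunc 0).Sends y₁ q) :
    A1Equiv k L φ X sX p q := by
  obtain ⟨F, hF, rfl, rfl⟩ := h
  obtain ⟨W, hWc, hWX, hWw, hWV⟩ := exists_endCone_place (L := L) 1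
  obtain ⟨W', hWc', hWX', hWw', hWV'⟩ := exists_endCone_place (L := L) (-1)
  let g : L[X] →+* FractionRing (AddMonoidAlgebra L (ℤ × ℤ)) :=
    eval₂RingHom (torusConst L) (torusMonomial L (1, 0))
  have hev : ∀ f : L[X], algebraMap L[X] (RatFunc L) f =
      f.eval₂ (algebraMap L (RatFunc L)) RatFunc.X := fun f => by
    rw [← RatFunc.algebraMap_X, ← aeval_def, aeval_algebraMap_apply, aeval_X_left_apply]
  have hg : ∀ f, W.rel (g f) (algebraMap L[X] (RatFunc L) f) := fun f => by
    rw [hev]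
    exact W.rel_eval₂ hWc hWX f
  have hg' : ∀ f, W'.rel (g f) (algebraMap L[X] (RatFunc L) f) := fun f => by
    rw [hev]
    exact W'.rel_eval₂ hWc' hWX' f
  obtain ⟨θ, hθ, hQ⟩ := W.exists_lift_of_rel g hg
  let w := torusMonomial L (0, 1)
  let σ := w / (w - 1)
  have hσ : W.rel σ 0 := by
    have := W.div hWw (W.sub hWw W.one) (by simp)
    simpa using this
  have hww : w * torusMonomial L (0, -1) = 1 := by
    rw [← map_mul, AddMonoidAlgebra.single_mul_single]
    simp only [Prod.mk_add_mk, add_zero, add_neg_cancel, mul_one]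
    exact map_one _
  have hσ' : W'.rel σ 1 := by
    have h1 := W'.div W'.one (W'.sub W'.one hWw') (by simp)
    have hw : w ≠ 0 := left_ne_zero_of_mul_eq_one hww
    have h2 : σ = 1 / (1 - torusMonomial L (0, -1)) := by
      rw [eq_inv_of_mul_eq_one_right hww, ← mul_div_mul_left 1 _ hw, mul_one, mul_sub, mul_one,
        mul_inv_cancel₀ hw]
    rw [h2]
    simpa using h1
  let G := specMapOf (eval₂RingHom θ σ) ≫ F
  have hG : G ≫ sX = specMapOf ((torusConst L).comp φ) := by
    rw [Category.assoc, hF, ← specMapOf_comp]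
    refine congrArg specMapOf (RingHom.ext fun r => ?_)
    have h1 : θ (algebraMap L (RatFunc L) (φ r)) = torusConst L (φ r) := by
      rw [IsScalarTower.algebraMap_apply L L[X] (RatFunc L), hθ]
      exact eval₂_C _ _
    exact (eval₂_C _ _).trans h1
  have hy : W.Sends G (specMapOf (evalRingHom 0) ≫ F) := W.sends_of_hom _ _
    (fun f => W.rel_eval₂ (g := RingHom.id _) (hQ W hg) hσ f) F
  have hy' : W'.Sends G (specMapOf (evalRingHom 1) ≫ F) := W'.sends_of_hom _ _
    (fun f => W'.rel_eval₂ (g := RingHom.id _) (hQ W' hg') hσ' f) F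
  obtain ⟨a, ha, -⟩ := ((endCone 1).place L).exists_sends sX (ψ := φ)
      (fun r => (endCone 1).place_rel_torusConst (φ r)) hG
  obtain ⟨b, hb, -⟩ := ((endCone (-1)).place L).exists_sends sX (ψ := φ)
      (fun r => (endCone (-1)).place_rel_torusConst (φ r)) hG
  rw [hp.unique (hy.of_comp hWV ha), hq.unique (hy'.of_comp hWV' hb)]
  exact a1Equiv_of_endCone hG ha hb

theorem ElemA1Equiv.comp_eq {M : Type} [Field M] {ψ : k →+* M}
    {x₀ x₁ : Spec (CommRingCat.of M) ⟶ X} (h : ElemA1Equiv k M ψ X sX x₀ x₁) :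
    x₀ ≫ sX = specMapOf ψ ∧ x₁ ≫ sX = specMapOf ψ := by
  obtain ⟨F, hF, rfl, rfl⟩ := h
  simp only [Category.assoc, hF, ← specMapOf_comp]
  constructor <;> congr 1 <;> ext r <;> simp

theorem a1Equiv_of_a1Equiv_ratFunc [IsProper sX] [X.IsSeparated]
    {y₀ y₁ : Spec (CommRingCat.of (RatFunc L)) ⟶ X}
    (h : A1Equiv k (RatFunc L) ((algebraMap L (RatFunc L)).comp φ) X sX y₀ y₁)
    (hy : y₀ ≫ sX = specMapOf ((algebraMap L (RatFunc L)).comp φ))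
    {p q : Spec (CommRingCat.of L) ⟶ X}
    (hp : (Place.ratFunc 0).Sends y₀ p) (hq : (Place.ratFunc 0).Sends y₁ q) :
    A1Equiv k L φ X sX p q := by
  suffices H : (y₀ ≫ sX = specMapOf ((algebraMap L (RatFunc L)).comp φ) ↔
      y₁ ≫ sX = specMapOf ((algebraMap L (RatFunc L)).comp φ)) ∧
      (y₀ ≫ sX = specMapOf ((algebraMap L (RatFunc L)).comp φ) →
        ∀ p q, (Place.ratFunc 0).Sends y₀ p → (Place.ratFunc 0).Sends y₁ q →
          A1Equiv k L φ X sX p q) from H.2 hy p q hp hq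
  clear hy hp hq
  induction h with
  | rel x y h =>
    exact ⟨iff_of_true h.comp_eq.1 h.comp_eq.2,
      fun _ _ _ hp hq => a1Equiv_of_elemA1Equiv_ratFunc h hp hq⟩
  | refl x =>
    refine ⟨.rfl, fun _ p q hp hq => ?_⟩
    rw [hp.unique hq]
    exact .refl _
  | symm x y _ ih =>
    exact ⟨ih.1.symm, fun hy p q hp hq => (ih.2 (ih.1.mpr hy) q p hq hp).symm⟩
  | trans x y z _ _ ih ih' =>
    refine ⟨ih.1.trans ih'.1, fun hx p q hp hq => ?_⟩
    obtain ⟨r, hr, -⟩ := (Place.ratFunc (0 : L)).exists_sends sX (ψ := φ)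
      (fun c => Place.ratFunc_const 0 (φ c)) (ih.1.mp hx)
    exact (ih.2 hx p r hp hr).trans _ _ _ (ih'.2 (ih.1.mp hx) r q hr hq)

theorem sends_ratFunc_const (x : Spec (CommRingCat.of L) ⟶ X) :
    (Place.ratFunc (0 : L)).Sends (specMapOf (algebraMap L (RatFunc L)) ≫ x) x := by
  have := (Place.ratFunc (0 : L)).sends_of_hom (algebraMap L (RatFunc L)) (RingHom.id L)
    (Place.ratFunc_const 0) x
  rwa [show specMapOf (RingHom.id L) = 𝟙 _ from Spec.map_id _, Category.id_comp] at this

end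

end

/-- If `X` is a proper `k`-scheme, `L` a field extension of `k`, and `x₀, x₁` are `L`-points
of `X` whose base changes along `π : Spec L(t) ⟶ Spec L` are `𝔸¹`-equivalent `L(t)`-points of
`X`, then `x₀` and `x₁` are `𝔸¹`-equivalent `L`-points of `X`; hence the natural map
`X(L)/∼ → X(L(t))/∼` on `𝔸¹`-equivalence classes is injective. -/
theorem a1Equiv_of_ratFunc_a1Equiv_of_proper
    (k : Type) [Field k]
    (X : Scheme) (sX : X ⟶ Spec (CommRingCat.of k)) (hX : IsProper sX)
    (L : Type) [Field L] [Algebra k L]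
    (x₀ x₁ : Spec (CommRingCat.of L) ⟶ X)
    (hx₀ : x₀ ≫ sX = specMapOf (algebraMap k L))
    (hx₁ : x₁ ≫ sX = specMapOf (algebraMap k L))
    (h : A1Equiv k (RatFunc L) ((algebraMap L (RatFunc L)).comp (algebraMap k L)) X sX
      (specMapOf (algebraMap L (RatFunc L)) ≫ x₀)
      (specMapOf (algebraMap L (RatFunc L)) ≫ x₁)) :
    A1Equiv k L (algebraMap k L) X sX x₀ x₁ := by
  have : X.IsSeparated := isSeparated_of_isSeparated_hom sX
  refine a1Equiv_of_a1Equiv_ratFunc h ?_ (sends_ratFunc_const x₀) (sends_ratFunc_const x₁)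
  rw [Category.assoc, hx₀, ← specMapOf_comp]

end
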